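/- There exists δ > 0, given explicitly by δ = (1/C₁)·[(α⁻+β⁻−p⁺)/(α⁻+β⁻−q⁻)]·[(p⁻−q⁺)/(C₂(α⁺+β⁺−q⁺))]^{(p⁺−q⁻)/(α⁻+β⁻−p⁺)}, such that for any pair of positive parameters (λ,μ) with λ+μ < δ, the degenerate part of the Nehari manifold is empty: N⁰_{λ,μ} = ∅. -/

import Mathlib

open MeasureTheory Real Set Filter Topology

noncomputable section

abbrev Euc (N : ℕ) := EuclideanSpace ℝ (Fin N)

/-- `Φ⁻ := inf_D Φ`. -/
def infOn {X : Type*} (g : X → ℝ) (D : Set X) : ℝ := sInf (g '' D)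

/-- `Φ⁺ := sup_D Φ`. -/
def supOn {X : Type*} (g : X → ℝ) (D : Set X) : ℝ := sSup (g '' D)

/-- `C₊(D)`: continuous on `D` with `1 < g⁻ ≤ g⁺ < ∞`. -/
def CPlus {X : Type*} [TopologicalSpace X] (D : Set X) (g : X → ℝ) : Prop :=
  ContinuousOn g D ∧ 1 < infOn g D ∧ BddAbove (g '' D)

variable {N : ℕ}

/-- the modular `ρ_γ(u) = ∫_Ω |u|^{γ(x)} dx`. -/
def modular (Ω : Set (Euc N)) (γ u : Euc N → ℝ) : ℝ := ∫ x in Ω, |u x| ^ γ x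

/-- membership in the variable exponent Lebesgue space `L^{γ(x)}(Ω)`. -/
def MemVarLp (Ω : Set (Euc N)) (γ u : Euc N → ℝ) : Prop :=
  AEMeasurable u (volume.restrict Ω) ∧ IntegrableOn (fun x => |u x| ^ γ x) Ω

/-- the Luxemburg norm on `L^{γ(x)}(Ω)`. -/
def luxNorm (Ω : Set (Euc N)) (γ u : Euc N → ℝ) : ℝ :=
  sInf {η : ℝ | 0 < η ∧ (∫ x in Ω, (|u x| / η) ^ γ x) ≤ 1}

/-- the scaled Gagliardo modular over a set `D ⊆ ℝ^N × ℝ^N`. -/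
def gagliardoOn (D : Set (Euc N × Euc N)) (s : ℝ) (p : Euc N × Euc N → ℝ)
    (u : Euc N → ℝ) (η : ℝ) : ℝ :=
  ∫ z in D, |u z.1 - u z.2| ^ p z / (η ^ p z * ‖z.1 - z.2‖ ^ ((N : ℝ) + s * p z))

/-- the seminorm `[u]_Ω^{s,p(x,y)}` of `W`. -/
def Wseminorm (Ω : Set (Euc N)) (s : ℝ) (p : Euc N × Euc N → ℝ) (u : Euc N → ℝ) : ℝ :=
  sInf {η : ℝ | 0 < η ∧ gagliardoOn (Ω ×ˢ Ω) s p u η < 1}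

/-- the norm of `W = W^{s,p̄(x),p(x,y)}(Ω)`. -/
def WNorm (Ω : Set (Euc N)) (s : ℝ) (p : Euc N × Euc N → ℝ) (u : Euc N → ℝ) : ℝ :=
  luxNorm Ω (fun x => p (x, x)) u + Wseminorm Ω s p u

/-- membership in `W = W^{s,p̄(x),p(x,y)}(Ω)`. -/
def MemW (Ω : Set (Euc N)) (s : ℝ) (p : Euc N × Euc N → ℝ) (u : Euc N → ℝ) : Prop :=
  Measurable u ∧ IntegrableOn (fun x => |u x| ^ p (x, x)) Ω ∧
    ∃ η > (0 : ℝ), IntegrableOn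
      (fun z : Euc N × Euc N =>
        |u z.1 - u z.2| ^ p z / (η ^ p z * ‖z.1 - z.2‖ ^ ((N : ℝ) + s * p z))) (Ω ×ˢ Ω)

/-- the modular `ρ_{X₀}`. -/
def rhoX0 (s : ℝ) (p : Euc N × Euc N → ℝ) (u : Euc N → ℝ) : ℝ :=
  ∫ z : Euc N × Euc N, |u z.1 - u z.2| ^ p z / ‖z.1 - z.2‖ ^ ((N : ℝ) + s * p z)

/-- the Luxemburg-type norm of `X₀`. -/
def X0Norm (s : ℝ) (p : Euc N × Euc N → ℝ) (u : Euc N → ℝ) : ℝ :=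
  sInf {η : ℝ | 0 < η ∧ gagliardoOn univ s p u η ≤ 1}

/-- membership in `X₀`: vanishing a.e. outside `Ω` and finite scaled Gagliardo modular. -/
def MemX0 (Ω : Set (Euc N)) (s : ℝ) (p : Euc N × Euc N → ℝ) (u : Euc N → ℝ) : Prop :=
  Measurable u ∧ (∀ᵐ x ∂(volume : Measure (Euc N)), x ∉ Ω → u x = 0) ∧
    ∃ η > (0 : ℝ), Integrable
      (fun z : Euc N × Euc N =>
        |u z.1 - u z.2| ^ p z / (η ^ p z * ‖z.1 - z.2‖ ^ ((N : ℝ) + s * p z)))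

/-- the norm `‖(u,v)‖ = max {‖u‖_{X₀}, ‖v‖_{X₀}}` on `E = X₀ × X₀`. -/
def pairNorm (s : ℝ) (p : Euc N × Euc N → ℝ) (u v : Euc N → ℝ) : ℝ :=
  max (X0Norm s p u) (X0Norm s p v)

/-- the critical exponent `p*_s(x) = N p̄(x)/(N − s p̄(x))`. -/
def pstar (N : ℕ) (s : ℝ) (p : Euc N × Euc N → ℝ) (x : Euc N) : ℝ :=
  (N : ℝ) * p (x, x) / ((N : ℝ) - s * p (x, x))

/-- `P(u,v)`. -/
def Pfun (s : ℝ) (p : Euc N × Euc N → ℝ) (u v : Euc N → ℝ) : ℝ :=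
  ∫ z : Euc N × Euc N,
    (|u z.1 - u z.2| ^ p z + |v z.1 - v z.2| ^ p z) / ‖z.1 - z.2‖ ^ ((N : ℝ) + s * p z)

/-- `Q(u,v)`. -/
def Qfun (Ω : Set (Euc N)) (q a b : Euc N → ℝ) (lam mu : ℝ) (u v : Euc N → ℝ) : ℝ :=
  ∫ x in Ω, (lam * a x * |u x| ^ q x + mu * b x * |v x| ^ q x)

/-- `R(u,v)`. -/
def Rfun (Ω : Set (Euc N)) (α β c : Euc N → ℝ) (u v : Euc N → ℝ) : ℝ :=
  ∫ x in Ω, c x * |u x| ^ α x * |v x| ^ β x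

/-- the energy functional `J_{λ,μ}`. -/
def Jfun (Ω : Set (Euc N)) (s : ℝ) (p : Euc N × Euc N → ℝ) (q α β a b c : Euc N → ℝ)
    (lam mu : ℝ) (u v : Euc N → ℝ) : ℝ :=
  (∫ z : Euc N × Euc N,
      (|u z.1 - u z.2| ^ p z + |v z.1 - v z.2| ^ p z) /
        (p z * ‖z.1 - z.2‖ ^ ((N : ℝ) + s * p z)))
  - (∫ x in Ω, (lam * a x * |u x| ^ q x + mu * b x * |v x| ^ q x) / q x)
  - ∫ x in Ω, c x * |u x| ^ α x * |v x| ^ β x / (α x + β x)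

/-- `φ''_{u,v}(1)`, the second derivative at `t = 1` of the fibering map. -/
def phiSecond (Ω : Set (Euc N)) (s : ℝ) (p : Euc N × Euc N → ℝ) (q α β a b c : Euc N → ℝ)
    (lam mu : ℝ) (u v : Euc N → ℝ) : ℝ :=
  (∫ z : Euc N × Euc N,
      (p z - 1) * (|u z.1 - u z.2| ^ p z + |v z.1 - v z.2| ^ p z) /
        ‖z.1 - z.2‖ ^ ((N : ℝ) + s * p z))
  - (∫ x in Ω, (q x - 1) * (lam * a x * |u x| ^ q x + mu * b x * |v x| ^ q x))
  - ∫ x in Ω, (α x + β x - 1) * (c x * |u x| ^ α x * |v x| ^ β x)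

/-- `(u,v) ≠ (0,0)` in `E`. -/
def Nontriv (u v : Euc N → ℝ) : Prop :=
  ¬ (u =ᵐ[(volume : Measure (Euc N))] 0 ∧ v =ᵐ[(volume : Measure (Euc N))] 0)

/-- membership in the Nehari manifold `N_{λ,μ}`:
`⟨J'(u,v),(u,v)⟩ = P(u,v) − Q(u,v) − R(u,v) = 0`. -/
def InNehari (Ω : Set (Euc N)) (s : ℝ) (p : Euc N × Euc N → ℝ) (q α β a b c : Euc N → ℝ)
    (lam mu : ℝ) (u v : Euc N → ℝ) : Prop :=
  MemX0 Ω s p u ∧ MemX0 Ω s p v ∧ Nontriv u v ∧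
    Pfun s p u v - Qfun Ω q a b lam mu u v - Rfun Ω α β c u v = 0

/-- `N⁺_{λ,μ}`. -/
def InNPlus (Ω : Set (Euc N)) (s : ℝ) (p : Euc N × Euc N → ℝ) (q α β a b c : Euc N → ℝ)
    (lam mu : ℝ) (u v : Euc N → ℝ) : Prop :=
  InNehari Ω s p q α β a b c lam mu u v ∧ 0 < phiSecond Ω s p q α β a b c lam mu u v

/-- `N⁻_{λ,μ}`. -/
def InNMinus (Ω : Set (Euc N)) (s : ℝ) (p : Euc N × Euc N → ℝ) (q α β a b c : Euc N → ℝ)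
    (lam mu : ℝ) (u v : Euc N → ℝ) : Prop :=
  InNehari Ω s p q α β a b c lam mu u v ∧ phiSecond Ω s p q α β a b c lam mu u v < 0

/-- `N⁰_{λ,μ}`. -/
def InNZero (Ω : Set (Euc N)) (s : ℝ) (p : Euc N × Euc N → ℝ) (q α β a b c : Euc N → ℝ)
    (lam mu : ℝ) (u v : Euc N → ℝ) : Prop :=
  InNehari Ω s p q α β a b c lam mu u v ∧ phiSecond Ω s p q α β a b c lam mu u v = 0

/-- `(u,v)` is a weak solution of the system, i.e. `J'_{λ,μ}(u,v) = 0` in the dual of `E`. -/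
def IsWeakSolution (Ω : Set (Euc N)) (s : ℝ) (p : Euc N × Euc N → ℝ)
    (q α β a b c : Euc N → ℝ) (lam mu : ℝ) (u v : Euc N → ℝ) : Prop :=
  ∀ φ ψ : Euc N → ℝ, MemX0 Ω s p φ → MemX0 Ω s p ψ →
    ((∫ z : Euc N × Euc N,
        |u z.1 - u z.2| ^ (p z - 2) * (u z.1 - u z.2) * (φ z.1 - φ z.2) /
          ‖z.1 - z.2‖ ^ ((N : ℝ) + s * p z))
      + ∫ z : Euc N × Euc N,
          |v z.1 - v z.2| ^ (p z - 2) * (v z.1 - v z.2) * (ψ z.1 - ψ z.2) /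
            ‖z.1 - z.2‖ ^ ((N : ℝ) + s * p z))
    = (∫ x in Ω, (lam * a x * |u x| ^ (q x - 2) * u x * φ x
        + mu * b x * |v x| ^ (q x - 2) * v x * ψ x))
      + (∫ x in Ω, α x / (α x + β x) * c x * |u x| ^ (α x - 2) * u x * |v x| ^ β x * φ x)
      + ∫ x in Ω, β x / (α x + β x) * c x * |v x| ^ (α x - 2) * v x * |u x| ^ β x * ψ x

/-- the standing hypotheses: `Ω` a bounded domain, `s ∈ (0,1)`, (P1)–(P2) with `s p⁺ < N`,
and (A1)–(A4). -/
def HypAll (N : ℕ) (Ω : Set (Euc N)) (s : ℝ) (p : Euc N × Euc N → ℝ)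
    (q α β a b c : Euc N → ℝ) : Prop :=
  2 ≤ N ∧ IsOpen Ω ∧ Bornology.IsBounded Ω ∧ Ω.Nonempty ∧
  0 < s ∧ s < 1 ∧
  CPlus univ p ∧ (∀ x y : Euc N, p (x, y) = p (y, x)) ∧ s * supOn p univ < (N : ℝ) ∧
  CPlus (closure Ω) q ∧ CPlus (closure Ω) α ∧ CPlus (closure Ω) β ∧
  supOn q (closure Ω) < infOn p univ ∧
  supOn p univ < infOn α (closure Ω) + infOn β (closure Ω) ∧
  supOn α (closure Ω) + supOn β (closure Ω) < infOn (pstar N s p) (closure Ω) ∧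
  infOn p univ / (supOn α (closure Ω) + supOn β (closure Ω)) <
    (infOn p univ - supOn q (closure Ω)) /
        (supOn α (closure Ω) + supOn β (closure Ω) - supOn q (closure Ω)) *
      ((infOn α (closure Ω) + infOn β (closure Ω) - infOn q (closure Ω)) /
        (supOn p univ - infOn q (closure Ω))) ∧
  Measurable a ∧ Measurable b ∧ Measurable c ∧
  (∀ x, 0 ≤ a x) ∧ (∀ x, 0 ≤ b x) ∧ (∀ x, 0 ≤ c x) ∧
  MemVarLp Ω (fun x => (α x + β x) / (α x + β x - q x)) a ∧
  MemVarLp Ω (fun x => (α x + β x) / (α x + β x - q x)) b ∧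
  (∃ M : ℝ, ∀ x, c x ≤ M)

/-- the estimate `Q(u,v) ≤ C₁(λ+μ)·max{‖(u,v)‖^{q⁻},‖(u,v)‖^{q⁺}}`. -/
def QEstimate (Ω : Set (Euc N)) (s : ℝ) (p : Euc N × Euc N → ℝ) (q a b : Euc N → ℝ)
    (C₁ : ℝ) : Prop :=
  ∀ lam mu : ℝ, 0 < lam → 0 < mu → ∀ u v : Euc N → ℝ,
    MemX0 Ω s p u → MemX0 Ω s p v →
      Qfun Ω q a b lam mu u v ≤ C₁ * (lam + mu) *
        max (pairNorm s p u v ^ infOn q (closure Ω))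
          (pairNorm s p u v ^ supOn q (closure Ω))

/-- the estimate `R(u,v) ≤ C₂·max{‖(u,v)‖^{α⁻+β⁻},‖(u,v)‖^{α⁺+β⁺}}`. -/
def REstimate (Ω : Set (Euc N)) (s : ℝ) (p : Euc N × Euc N → ℝ) (α β c : Euc N → ℝ)
    (C₂ : ℝ) : Prop :=
  ∀ u v : Euc N → ℝ, MemX0 Ω s p u → MemX0 Ω s p v →
    Rfun Ω α β c u v ≤ C₂ *
      max (pairNorm s p u v ^ (infOn α (closure Ω) + infOn β (closure Ω)))
        (pairNorm s p u v ^ (supOn α (closure Ω) + supOn β (closure Ω)))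

/-- the threshold
`δ = (1/C₁)·[(α⁻+β⁻−p⁺)/(α⁻+β⁻−q⁻)]·[(p⁻−q⁺)/(C₂(α⁺+β⁺−q⁺))]^{(p⁺−q⁻)/(α⁻+β⁻−p⁺)}`. -/
def deltaConst (Ω : Set (Euc N)) (p : Euc N × Euc N → ℝ) (q α β : Euc N → ℝ)
    (C₁ C₂ : ℝ) : ℝ :=
  (1 / C₁) *
    ((infOn α (closure Ω) + infOn β (closure Ω) - supOn p univ) /
      (infOn α (closure Ω) + infOn β (closure Ω) - infOn q (closure Ω))) *
    ((infOn p univ - supOn q (closure Ω)) /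
        (C₂ * (supOn α (closure Ω) + supOn β (closure Ω) - supOn q (closure Ω)))) ^
      ((supOn p univ - infOn q (closure Ω)) /
        (infOn α (closure Ω) + infOn β (closure Ω) - supOn p univ))

/-- scaling `t·u`. -/
def scale (t : ℝ) (u : Euc N → ℝ) : Euc N → ℝ := fun x => t * u x

/-- weak convergence `u_m ⇀ u` in `X₀`, tested through the isometric embedding
`u ↦ (u(x)−u(y))` of `X₀` into `L^{p(x,y)}(dx dy/|x−y|^{N+sp(x,y)})`. -/
def WeakTendstoX0 (s : ℝ) (p : Euc N × Euc N → ℝ) (um : ℕ → Euc N → ℝ)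
    (u : Euc N → ℝ) : Prop :=
  ∀ g : Euc N × Euc N → ℝ, Measurable g →
    Integrable (fun z : Euc N × Euc N =>
      |g z| ^ (p z / (p z - 1)) / ‖z.1 - z.2‖ ^ ((N : ℝ) + s * p z)) →
    Tendsto (fun m => ∫ z : Euc N × Euc N,
        (um m z.1 - um m z.2) * g z / ‖z.1 - z.2‖ ^ ((N : ℝ) + s * p z)) atTop
      (𝓝 (∫ z : Euc N × Euc N, (u z.1 - u z.2) * g z / ‖z.1 - z.2‖ ^ ((N : ℝ) + s * p z)))

theorem CPlus.infOn_le {X : Type*} [TopologicalSpace X] {D : Set X} {g : X → ℝ}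
    (hg : CPlus D g) {x : X} (hx : x ∈ D) : infOn g D ≤ g x := by
  refine csInf_le ?_ (mem_image_of_mem g hx)
  by_contra hb
  have h1 := hg.2.1
  rw [infOn, Real.sInf_of_not_bddBelow hb] at h1
  linarith

theorem CPlus.le_supOn {X : Type*} [TopologicalSpace X] {D : Set X} {g : X → ℝ}
    (hg : CPlus D g) {x : X} (hx : x ∈ D) : g x ≤ supOn g D :=
  le_csSup hg.2.2 (mem_image_of_mem g hx)

theorem CPlus.infOn_le_supOn {X : Type*} [TopologicalSpace X] {D : Set X} {g : X → ℝ}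
    (hg : CPlus D g) (hD : D.Nonempty) : infOn g D ≤ supOn g D :=
  (hg.infOn_le hD.some_mem).trans (hg.le_supOn hD.some_mem)

theorem min_rpow_le_rpow {η lo hi r : ℝ} (hη : 0 < η) (h1 : lo ≤ r) (h2 : r ≤ hi) :
    min (η ^ lo) (η ^ hi) ≤ η ^ r := by
  rcases le_total 1 η with h | h
  · exact (min_le_left _ _).trans (rpow_le_rpow_of_exponent_le h h1)
  · exact (min_le_right _ _).trans (rpow_le_rpow_of_exponent_ge hη h h2)

/-- A nonnegative function that is pointwise an eventual limit of integrable functions with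
uniformly bounded integrals is integrable. -/
theorem integrable_of_integral_le_of_tendsto {X : Type*} [MeasurableSpace X] {μ : Measure X}
    {F : ℕ → X → ℝ} {f : X → ℝ} {C : ℝ} (hF : ∀ n, Integrable (F n) μ)
    (hF0 : ∀ n x, 0 ≤ F n x) (hC : ∀ n, ∫ x, F n x ∂μ ≤ C)
    (hlim : ∀ x, Tendsto (fun n => F n x) atTop (𝓝 (f x))) : Integrable f μ := by
  refine ⟨aestronglyMeasurable_of_tendsto_ae _ (fun n => (hF n).1) (ae_of_all _ hlim), ?_⟩
  have h1 : ∫⁻ x, ‖f x‖ₑ ∂μ ≤ liminf (fun n => ∫⁻ x, ‖F n x‖ₑ ∂μ) atTop := by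
    rw [lintegral_congr fun x => (hlim x).enorm.liminf_eq.symm]
    exact lintegral_liminf_le' fun n => (hF n).1.enorm
  have h2 : ∀ n, ∫⁻ x, ‖F n x‖ₑ ∂μ ≤ ENNReal.ofReal C := fun n => by
    have : ∫⁻ x, ‖F n x‖ₑ ∂μ = ENNReal.ofReal (∫ x, F n x ∂μ) := by
      rw [ofReal_integral_eq_lintegral_ofReal (hF n) (ae_of_all _ (hF0 n))]
      exact lintegral_congr fun x => Real.enorm_of_nonneg (hF0 n x)
    rw [this]
    exact ENNReal.ofReal_le_ofReal (hC n)
  refine (h1.trans (liminf_le_of_le ?_ ?_)).trans_lt (ENNReal.ofReal_lt_top (r := C))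
  · isBoundedDefault
  · intro b hb
    obtain ⟨n, hn⟩ := hb.exists
    exact hn.trans (h2 n)

/-- The integrand of the Gagliardo modular `rhoX0`. -/
def gagliardoDensity (s : ℝ) (p : Euc N × Euc N → ℝ) (u : Euc N → ℝ) (z : Euc N × Euc N) : ℝ :=
  |u z.1 - u z.2| ^ p z / ‖z.1 - z.2‖ ^ ((N : ℝ) + s * p z)

section Gagliardo

variable {Ω : Set (Euc N)} {s : ℝ} {p : Euc N × Euc N → ℝ} {u v w : Euc N → ℝ}

theorem gagliardoDensity_nonneg (z : Euc N × Euc N) : 0 ≤ gagliardoDensity s p u z := by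
  unfold gagliardoDensity; positivity

theorem measurable_gagliardoDensity (hp : Measurable p) (hu : Measurable u) :
    Measurable (gagliardoDensity s p u) := by
  unfold gagliardoDensity
  fun_prop

theorem scaled_density_eq (η : ℝ) (z : Euc N × Euc N) :
    |u z.1 - u z.2| ^ p z / (η ^ p z * ‖z.1 - z.2‖ ^ ((N : ℝ) + s * p z)) =
      (η ^ p z)⁻¹ * gagliardoDensity s p u z := by
  simp only [gagliardoDensity, div_eq_mul_inv, mul_inv]
  ring

theorem gagliardoDensity_mono (hp : CPlus univ p)
    (hw : ∀ x y, |w x - w y| ≤ |u x - u y|) (z : Euc N × Euc N) :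
    gagliardoDensity s p w z ≤ gagliardoDensity s p u z := by
  have hpz : 0 ≤ p z := by linarith [hp.2.1, hp.infOn_le (mem_univ z)]
  exact div_le_div_of_nonneg_right (rpow_le_rpow (abs_nonneg _) (hw _ _) hpz) (by positivity)

theorem CPlus.measurable (hp : CPlus univ p) : Measurable p :=
  (continuousOn_univ.mp hp.1).measurable

theorem integrable_rpow_mul (hp : CPlus univ p) {f : Euc N × Euc N → ℝ} (hf : Integrable f)
    {η : ℝ} (hη : 0 < η) : Integrable fun z => η ^ p z * f z := by
  have hpm := hp.measurable
  refine hf.bdd_mul (f := fun z => η ^ p z)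
    (c := max (η ^ infOn p univ) (η ^ supOn p univ)) ?_ ?_
  · exact Measurable.aestronglyMeasurable (by fun_prop)
  · refine ae_of_all _ fun z => ?_
    rw [Real.norm_of_nonneg (by positivity)]
    rcases le_total 1 η with h | h
    · exact le_max_of_le_right (rpow_le_rpow_of_exponent_le h (hp.le_supOn (mem_univ z)))
    · exact le_max_of_le_left (rpow_le_rpow_of_exponent_ge hη h (hp.infOn_le (mem_univ z)))

theorem MemX0.integrable_density (hp : CPlus univ p) (hu : MemX0 Ω s p u) :
    Integrable (gagliardoDensity s p u) := by
  obtain ⟨-, -, η, hη, hi⟩ := hu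
  refine (integrable_rpow_mul hp hi hη).congr (ae_of_all _ fun z => ?_)
  have : η ^ p z ≠ 0 := (rpow_pos_of_pos hη _).ne'
  simp only [scaled_density_eq]
  field_simp

theorem gagliardoOn_le (hp : CPlus univ p) (hu : Integrable (gagliardoDensity s p u))
    {η : ℝ} (hη : 0 < η) :
    gagliardoOn univ s p u η ≤
      (min (η ^ infOn p univ) (η ^ supOn p univ))⁻¹ * ∫ z, gagliardoDensity s p u z := by
  rw [gagliardoOn, setIntegral_univ, ← integral_const_mul]
  simp only [scaled_density_eq]
  refine integral_mono_of_nonneg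
    (ae_of_all _ fun z => mul_nonneg (by positivity) (gagliardoDensity_nonneg z))
    (hu.const_mul _) (ae_of_all _ fun z => ?_)
  refine mul_le_mul_of_nonneg_right ?_ (gagliardoDensity_nonneg z)
  exact inv_anti₀ (lt_min (by positivity) (by positivity))
    (min_rpow_le_rpow hη (hp.infOn_le (mem_univ z)) (hp.le_supOn (mem_univ z)))

theorem X0Norm_nonneg : 0 ≤ X0Norm s p u := Real.sInf_nonneg fun _ h => h.1.le

theorem gagliardoOn_le_one (hp : CPlus univ p) (hu : Integrable (gagliardoDensity s p u))
    {η : ℝ} (hη : 0 < η)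
    (h : ∫ z, gagliardoDensity s p u z ≤ min (η ^ infOn p univ) (η ^ supOn p univ)) :
    gagliardoOn univ s p u η ≤ 1 := by
  have : 0 < min (η ^ infOn p univ) (η ^ supOn p univ) :=
    lt_min (by positivity) (by positivity)
  refine (gagliardoOn_le hp hu hη).trans ?_
  rwa [inv_mul_eq_div, div_le_one this]

theorem X0Norm_le (hp : CPlus univ p) (hu : Integrable (gagliardoDensity s p u))
    {η : ℝ} (hη : 0 < η)
    (h : ∫ z, gagliardoDensity s p u z ≤ min (η ^ infOn p univ) (η ^ supOn p univ)) :
    X0Norm s p u ≤ η :=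
  csInf_le ⟨0, fun _ h => h.1.le⟩ ⟨hη, gagliardoOn_le_one hp hu hη h⟩

theorem le_min_max_one_rpow (hp : CPlus univ p) (I : ℝ) :
    I ≤ min (max 1 I ^ infOn p univ) (max 1 I ^ supOn p univ) := by
  have hM := hp.infOn_le_supOn univ_nonempty
  have hη : 1 ≤ max 1 I := le_max_left _ _
  exact (le_max_right 1 _).trans (le_min (self_le_rpow_of_one_le hη hp.2.1.le)
    (self_le_rpow_of_one_le hη (hp.2.1.le.trans hM)))

theorem min_X0Norm_rpow_le (hp : CPlus univ p) (hu : Integrable (gagliardoDensity s p u)) :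
    min (X0Norm s p u ^ infOn p univ) (X0Norm s p u ^ supOn p univ) ≤
      ∫ z, gagliardoDensity s p u z := by
  have hm : 1 < infOn p univ := hp.2.1
  have hM := hp.infOn_le_supOn univ_nonempty
  rcases X0Norm_nonneg.eq_or_lt (a := 0) (b := X0Norm s p u) with h0 | h0
  · rw [← h0, zero_rpow (by linarith), zero_rpow (by linarith), min_self]
    exact integral_nonneg gagliardoDensity_nonneg
  have hc : Tendsto (fun η : ℝ => min (η ^ infOn p univ) (η ^ supOn p univ))
      (𝓝[<] (X0Norm s p u))
      (𝓝 (min (X0Norm s p u ^ infOn p univ) (X0Norm s p u ^ supOn p univ))) := by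
    refine Tendsto.mono_left (ContinuousAt.tendsto ?_) nhdsWithin_le_nhds
    exact (continuousAt_rpow_const _ _ (Or.inl h0.ne')).min
      (continuousAt_rpow_const _ _ (Or.inl h0.ne'))
  refine le_of_tendsto hc ?_
  filter_upwards [Ioo_mem_nhdsLT h0] with η hη
  by_contra! hlt
  exact absurd (X0Norm_le hp hu hη.1 hlt.le) (not_le.mpr hη.2)

theorem exists_forall_X0Norm_le (hp : CPlus univ p) (hu : MemX0 Ω s p u) :
    ∃ M : ℝ, ∀ w : Euc N → ℝ, MemX0 Ω s p w → (∀ x y, |w x - w y| ≤ |u x - u y|) →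
      X0Norm s p w ≤ M := by
  refine ⟨max 1 (∫ z, gagliardoDensity s p u z), fun w hw hle =>
    X0Norm_le hp (hw.integrable_density hp) (by positivity) ?_⟩
  exact (integral_mono (hw.integrable_density hp) (hu.integrable_density hp)
    (gagliardoDensity_mono hp hle)).trans (le_min_max_one_rpow hp _)

theorem MemX0.of_abs_sub_le (hp : CPlus univ p) (hu : MemX0 Ω s p u) (hw : Measurable w)
    (hw0 : ∀ x, u x = 0 → w x = 0) (hle : ∀ x y, |w x - w y| ≤ |u x - u y|) :
    MemX0 Ω s p w := by
  have hi : Integrable (gagliardoDensity s p w) := by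
    refine (hu.integrable_density hp).mono'
      (measurable_gagliardoDensity hp.measurable hw).aestronglyMeasurable
      (ae_of_all _ fun z => ?_)
    rw [Real.norm_of_nonneg (gagliardoDensity_nonneg z)]
    exact gagliardoDensity_mono hp hle z
  exact ⟨hw, hu.2.1.mono fun x hx hxΩ => hw0 x (hx hxΩ), 1, one_pos,
    hi.congr (ae_of_all _ fun z => by simp [gagliardoDensity])⟩

theorem integral_density_eq_zero (hp : CPlus univ p) (hu : Integrable (gagliardoDensity s p u))
    (h0 : X0Norm s p u = 0) : ∫ z, gagliardoDensity s p u z = 0 := by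
  refine le_antisymm (le_of_forall_pos_le_add fun ε hε => ?_)
    (integral_nonneg gagliardoDensity_nonneg)
  have hne : {η : ℝ | 0 < η ∧ gagliardoOn univ s p u η ≤ 1}.Nonempty :=
    ⟨_, lt_max_of_lt_left one_pos,
      gagliardoOn_le_one hp hu (lt_max_of_lt_left one_pos) (le_min_max_one_rpow hp _)⟩
  obtain ⟨η, ⟨hη, hle⟩, hηε⟩ := exists_lt_of_csInf_lt hne
    (show X0Norm s p u < min 1 ε by rw [h0]; positivity)
  have hη1 : η ≤ 1 := hηε.le.trans (min_le_left _ _)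
  rw [gagliardoOn, setIntegral_univ] at hle
  simp only [scaled_density_eq] at hle
  have hi : Integrable fun z => (η ^ p z)⁻¹ * gagliardoDensity s p u z := by
    simpa only [inv_rpow hη.le] using integrable_rpow_mul hp hu (inv_pos.mpr hη)
  calc ∫ z, gagliardoDensity s p u z
      ≤ ∫ z, η * ((η ^ p z)⁻¹ * gagliardoDensity s p u z) := by
        refine integral_mono hu (hi.const_mul η) fun z => ?_
        have h1 : η ^ p z ≤ η := by
          simpa using rpow_le_rpow_of_exponent_ge hη hη1
            (hp.2.1.le.trans (hp.infOn_le (mem_univ z)))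
        have h2 : 1 ≤ η * (η ^ p z)⁻¹ := by
          rw [← div_eq_mul_inv, one_le_div (by positivity)]
          exact h1
        have h3 := gagliardoDensity_nonneg (s := s) (p := p) (u := u) z
        simp only
        rw [← mul_assoc]
        exact le_mul_of_one_le_left h3 h2
    _ = η * ∫ z, (η ^ p z)⁻¹ * gagliardoDensity s p u z := integral_const_mul _ _
    _ ≤ η * 1 := by gcongr
    _ ≤ 0 + ε := by linarith [hηε.le.trans (min_le_right _ _)]

theorem eq_of_gagliardoDensity_eq_zero (hp : CPlus univ p) {z : Euc N × Euc N}
    (h : gagliardoDensity s p u z = 0) : u z.1 = u z.2 := by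
  have hpz : p z ≠ 0 := by linarith [hp.2.1, hp.infOn_le (mem_univ z)]
  rcases div_eq_zero_iff.mp h with h | h
  · rw [rpow_eq_zero (abs_nonneg _) hpz, abs_eq_zero, sub_eq_zero] at h
    exact h
  · rw [rpow_eq_zero_iff_of_nonneg (norm_nonneg _), norm_eq_zero, sub_eq_zero] at h
    rw [h.1]

theorem MemX0.ae_eq_zero_of_X0Norm_eq_zero (hN : N ≠ 0) (hΩ : Bornology.IsBounded Ω)
    (hp : CPlus univ p) (hu : MemX0 Ω s p u) (h0 : X0Norm s p u = 0) :
    u =ᵐ[volume] 0 := by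
  have hui := hu.integrable_density hp
  have hae := (integral_eq_zero_iff_of_nonneg gagliardoDensity_nonneg hui).mp
    (integral_density_eq_zero hp hui h0)
  rw [Measure.volume_eq_prod] at hae
  filter_upwards [Measure.ae_ae_of_ae_prod hae] with x hx
  by_contra hne
  have hall : ∀ᵐ y ∂(volume : Measure (Euc N)), y ∈ (univ : Set (Euc N)) → y ∈ Ω := by
    filter_upwards [hx, hu.2.1] with y hy hyΩ _
    by_contra hyn
    exact hne ((eq_of_gagliardoDensity_eq_zero hp hy).trans (hyΩ hyn))
  have : Nonempty (Fin N) := Fin.pos_iff_nonempty.mp (Nat.pos_of_ne_zero hN)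
  have hlt : volume (univ : Set (Euc N)) < ⊤ := (measure_mono_ae hall).trans_lt hΩ.measure_lt_top
  rw [measure_univ_of_isAddLeftInvariant] at hlt
  exact lt_irrefl _ hlt

theorem min_pairNorm_rpow_le_Pfun (hp : CPlus univ p) (hu : MemX0 Ω s p u) (hv : MemX0 Ω s p v) :
    min (pairNorm s p u v ^ infOn p univ) (pairNorm s p u v ^ supOn p univ) ≤
      Pfun s p u v := by
  have hui := hu.integrable_density hp
  have hvi := hv.integrable_density hp
  have hP : Pfun s p u v =
      (∫ z, gagliardoDensity s p u z) + ∫ z, gagliardoDensity s p v z := by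
    rw [← integral_add hui hvi]
    simp only [Pfun, gagliardoDensity, add_div]
  have hu0 : 0 ≤ ∫ z, gagliardoDensity s p u z := integral_nonneg gagliardoDensity_nonneg
  have hv0 : 0 ≤ ∫ z, gagliardoDensity s p v z := integral_nonneg gagliardoDensity_nonneg
  rw [hP, pairNorm]
  rcases max_choice (X0Norm s p u) (X0Norm s p v) with h | h <;> rw [h]
  · linarith [min_X0Norm_rpow_le hp hui]
  · linarith [min_X0Norm_rpow_le hp hvi]

theorem pairNorm_pos (hN : N ≠ 0) (hΩ : Bornology.IsBounded Ω) (hp : CPlus univ p)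
    (hu : MemX0 Ω s p u) (hv : MemX0 Ω s p v) (huv : Nontriv u v) : 0 < pairNorm s p u v := by
  by_contra! h
  have h1 := (le_max_left _ _).trans h
  have h2 := (le_max_right _ _).trans h
  exact huv ⟨hu.ae_eq_zero_of_X0Norm_eq_zero hN hΩ hp (h1.antisymm X0Norm_nonneg),
    hv.ae_eq_zero_of_X0Norm_eq_zero hN hΩ hp (h2.antisymm X0Norm_nonneg)⟩

end Gagliardo

theorem nehari_inequalities_incompatible {pm pp qm qp Am Ap C₁ C₂ L n P Q R : ℝ}
    (hq : qm ≤ qp) (hqp : qp < pm) (hp : pm ≤ pp) (hpA : pp < Am) (hA : Am ≤ Ap)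
    (hC₁ : 0 < C₁) (hC₂ : 1 < C₂) (hn : 0 < n)
    (hP : min (n ^ pm) (n ^ pp) ≤ P) (hQ : Q ≤ C₁ * L * max (n ^ qm) (n ^ qp))
    (hR : R ≤ C₂ * max (n ^ Am) (n ^ Ap)) (hPQR : P = Q + R)
    (hlow : pm * P ≤ qp * Q + Ap * R) (hupp : qm * Q + Am * R ≤ pp * P)
    (hL : L < (1 / C₁) * ((Am - pp) / (Am - qm)) *
      ((pm - qp) / (C₂ * (Ap - qp))) ^ ((pp - qm) / (Am - pp))) : False := by
  set k := (pm - qp) / (C₂ * (Ap - qp)) with hk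
  set e := (pp - qm) / (Am - pp) with he
  set K := (Am - pp) / (Am - qm) with hK
  have hAq : 0 < Ap - qp := by linarith
  have hk0 : 0 < k := div_pos (by linarith) (by positivity)
  have hk1 : k ≤ 1 := by
    rw [hk, div_le_one (by positivity)]
    nlinarith
  have he0 : 0 < e := div_pos (by linarith) (by linarith)
  have hK0 : 0 < K := div_pos (by linarith) (by linarith)
  have hkR : k * P ≤ max (n ^ Am) (n ^ Ap) := by
    have h1 : (pm - qp) * P ≤ C₂ * (Ap - qp) * max (n ^ Am) (n ^ Ap) := by
      calc (pm - qp) * P ≤ (Ap - qp) * R := by subst hPQR; linarith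
        _ ≤ (Ap - qp) * (C₂ * max (n ^ Am) (n ^ Ap)) := by gcongr
        _ = _ := by ring
    rw [hk, div_mul_eq_mul_div, div_le_iff₀ (by positivity)]
    linarith
  have hKQ : K * P ≤ Q := by
    rw [hK, div_mul_eq_mul_div, div_le_iff₀ (by linarith)]
    subst hPQR; linarith
  have hCL : C₁ * L < K * k ^ e := by
    have := mul_lt_mul_of_pos_left hL hC₁
    calc C₁ * L < C₁ * (1 / C₁ * K * k ^ e) := this
      _ = K * k ^ e := by field_simp
  have hmax : 0 < max (n ^ qm) (n ^ qp) := lt_max_of_lt_left (by positivity)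
  have hPk : P < k ^ e * max (n ^ qm) (n ^ qp) := by
    have : K * P < K * (k ^ e * max (n ^ qm) (n ^ qp)) := by
      calc K * P ≤ C₁ * L * max (n ^ qm) (n ^ qp) := hKQ.trans hQ
        _ < K * k ^ e * max (n ^ qm) (n ^ qp) := by gcongr
        _ = _ := by ring
    exact lt_of_mul_lt_mul_left this hK0.le
  rcases le_total 1 n with h1 | h1
  · rw [min_eq_left (rpow_le_rpow_of_exponent_le h1 hp)] at hP
    rw [max_eq_right (rpow_le_rpow_of_exponent_le h1 hq)] at hPk
    have h2 : n ^ qp ≤ n ^ pm := rpow_le_rpow_of_exponent_le h1 hqp.le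
    have h3 : k ^ e ≤ 1 := rpow_le_one hk0.le hk1 he0.le
    have h4 : 0 < n ^ qp := by positivity
    nlinarith
  · rw [min_eq_right (rpow_le_rpow_of_exponent_ge hn h1 hp)] at hP
    rw [max_eq_left (rpow_le_rpow_of_exponent_ge hn h1 hq)] at hPk
    rw [max_eq_left (rpow_le_rpow_of_exponent_ge hn h1 hA)] at hkR
    have h2 : k ≤ n ^ (Am - pp) := by
      rw [rpow_sub hn, le_div_iff₀ (by positivity)]
      exact (mul_le_mul_of_nonneg_left hP hk0.le).trans hkR
    have h3 : k ^ e ≤ n ^ (pp - qm) := by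
      calc k ^ e ≤ (n ^ (Am - pp)) ^ e := rpow_le_rpow hk0.le h2 he0.le
        _ = n ^ (pp - qm) := by
          rw [← rpow_mul hn.le, he, mul_div_cancel₀]
          linarith
    rw [rpow_sub hn, le_div_iff₀ (by positivity)] at h3
    linarith

/-- Truncation of a real number to `[-k, k]`. -/
def trunc (k : ℕ) (t : ℝ) : ℝ := max (min t k) (-k)

theorem abs_trunc_le (k : ℕ) (t : ℝ) : |trunc k t| ≤ k := by
  have hk : (0 : ℝ) ≤ k := k.cast_nonneg
  exact abs_le.mpr ⟨le_max_right _ _, max_le (min_le_right _ _) (by linarith)⟩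

theorem trunc_zero (k : ℕ) : trunc k 0 = 0 := by simp [trunc]

theorem abs_trunc_sub_trunc_le (k : ℕ) (t r : ℝ) : |trunc k t - trunc k r| ≤ |t - r| := by
  refine (abs_max_sub_max_le_abs _ _ _).trans ?_
  simpa using abs_min_sub_min_le_max t k r k

theorem measurable_trunc (k : ℕ) : Measurable (trunc k) := by
  unfold trunc
  fun_prop

theorem trunc_eventually_eq (t : ℝ) : ∀ᶠ k : ℕ in atTop, trunc k t = t := by
  filter_upwards [eventually_ge_atTop ⌈|t|⌉₊] with k hk
  have h := abs_le.mp ((Nat.le_ceil |t|).trans (Nat.cast_le.mpr hk))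
  rw [trunc, min_eq_left h.2, max_eq_left h.1]

theorem abs_trunc_rpow_le (k : ℕ) (t : ℝ) {r R : ℝ} (hr : 0 ≤ r) (hR : r ≤ R) :
    |trunc k t| ^ r ≤ (max 1 (k : ℝ)) ^ R :=
  (rpow_le_rpow (abs_nonneg _) ((abs_trunc_le k t).trans (le_max_right _ _)) hr).trans
    (rpow_le_rpow_of_exponent_le (le_max_left _ _) hR)

section Integrability

variable {Ω : Set (Euc N)} {s : ℝ} {p : Euc N × Euc N → ℝ} {u v : Euc N → ℝ}

/-- A nonnegative functional on pairs controlled by powers of the norm, and integrable along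
truncations, has an integrable density. -/
theorem integrableOn_of_trunc (hp : CPlus univ p) (hu : MemX0 Ω s p u) (hv : MemX0 Ω s p v)
    {G : Euc N → ℝ → ℝ → ℝ} (hG0 : ∀ x t r, 0 ≤ G x t r) {C lo hi : ℝ} (hC : 0 ≤ C)
    (hlo : 0 ≤ lo) (hhi : 0 ≤ hi)
    (hbound : ∀ u v : Euc N → ℝ, MemX0 Ω s p u → MemX0 Ω s p v →
      ∫ x in Ω, G x (u x) (v x) ≤ C * max (pairNorm s p u v ^ lo) (pairNorm s p u v ^ hi))
    (hG : ∀ k : ℕ, IntegrableOn (fun x => G x (trunc k (u x)) (trunc k (v x))) Ω) :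
    IntegrableOn (fun x => G x (u x) (v x)) Ω := by
  have hmem : ∀ (w : Euc N → ℝ) (k : ℕ), MemX0 Ω s p w → MemX0 Ω s p fun x => trunc k (w x) :=
    fun w k hw => hw.of_abs_sub_le hp ((measurable_trunc k).comp hw.1)
      (fun x hx => by rw [hx, trunc_zero]) (fun x y => abs_trunc_sub_trunc_le k _ _)
  obtain ⟨M₁, hM₁⟩ := exists_forall_X0Norm_le hp hu
  obtain ⟨M₂, hM₂⟩ := exists_forall_X0Norm_le hp hv
  refine integrable_of_integral_le_of_tendsto
    (C := C * max (max M₁ M₂ ^ lo) (max M₁ M₂ ^ hi)) hG (fun k x => hG0 _ _ _) (fun k => ?_)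
    fun x => ?_
  · refine (hbound _ _ (hmem u k hu) (hmem v k hv)).trans ?_
    have h1 : pairNorm s p (fun x => trunc k (u x)) (fun x => trunc k (v x)) ≤ max M₁ M₂ :=
      max_le_max (hM₁ _ (hmem u k hu) fun x y => abs_trunc_sub_trunc_le k _ _)
        (hM₂ _ (hmem v k hv) fun x y => abs_trunc_sub_trunc_le k _ _)
    have h0 : 0 ≤ pairNorm s p (fun x => trunc k (u x)) (fun x => trunc k (v x)) :=
      le_max_of_le_left X0Norm_nonneg
    gcongr
  · refine tendsto_const_nhds.congr' ?_
    filter_upwards [trunc_eventually_eq (u x), trunc_eventually_eq (v x)] with k h1 h2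
    rw [h1, h2]

theorem CPlus.aemeasurable {g : Euc N → ℝ} (hg : CPlus (closure Ω) g)
    (hΩ : IsOpen Ω) : AEMeasurable g (volume.restrict Ω) :=
  (hg.1.mono subset_closure).aemeasurable hΩ.measurableSet

theorem integrableOn_mul_trunc_rpow {f r w : Euc N → ℝ} (hΩ : IsOpen Ω)
    (hr : CPlus (closure Ω) r) (hw : Measurable w) (hf : IntegrableOn f Ω) (k : ℕ) :
    IntegrableOn (fun x => f x * |trunc k (w x)| ^ r x) Ω := by
  refine Integrable.mul_bdd (c := (max 1 (k : ℝ)) ^ supOn r (closure Ω)) hf ?_ ?_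
  · have h1 : Measurable fun x => |trunc k (w x)| := ((measurable_trunc k).comp hw).abs
    exact (h1.aemeasurable.pow (hr.aemeasurable hΩ)).aestronglyMeasurable
  · filter_upwards [ae_restrict_mem hΩ.measurableSet] with x hx
    rw [Real.norm_of_nonneg (by positivity)]
    exact abs_trunc_rpow_le k _ (by linarith [hr.2.1, hr.infOn_le (subset_closure hx)])
      (hr.le_supOn (subset_closure hx))

theorem MemVarLp.integrableOn {γ f : Euc N → ℝ} (hΩ : IsOpen Ω) (hb : Bornology.IsBounded Ω)
    (hγ : ∀ x ∈ Ω, 1 ≤ γ x) (hf : MemVarLp Ω γ f) : IntegrableOn f Ω := by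
  have h1 : IntegrableOn (fun _ : Euc N => (1 : ℝ)) Ω :=
    integrableOn_const hb.measure_lt_top.ne
  refine (h1.add hf.2).mono' hf.1.aestronglyMeasurable ?_
  filter_upwards [ae_restrict_mem hΩ.measurableSet] with x hx
  simp only [Pi.add_apply, Real.norm_eq_abs]
  have h2 : 0 ≤ |f x| ^ γ x := by positivity
  rcases le_total 1 |f x| with h | h
  · linarith [self_le_rpow_of_one_le h (hγ x hx)]
  · linarith

/-- Two-sided bound for a weighted integral of a nonnegative function. -/
theorem integral_mul_mem_Icc {X : Type*} [MeasurableSpace X] {μ : Measure X} {f g : X → ℝ}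
    {m M : ℝ} (hf : Integrable f μ) (hf0 : ∀ x, 0 ≤ f x) (hg : AEStronglyMeasurable g μ)
    (hm : ∀ᵐ x ∂μ, m ≤ g x) (hM : ∀ᵐ x ∂μ, g x ≤ M) :
    ∫ x, g x * f x ∂μ ∈ Icc (m * ∫ x, f x ∂μ) (M * ∫ x, f x ∂μ) := by
  have hi : Integrable (fun x => g x * f x) μ := by
    refine hf.bdd_mul (c := max |m| |M|) hg ?_
    filter_upwards [hm, hM] with x h1 h2
    exact abs_le_max_abs_abs h1 h2
  rw [← integral_const_mul, ← integral_const_mul]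
  constructor
  · refine integral_mono_ae (hf.const_mul m) hi ?_
    filter_upwards [hm] with x h
    exact mul_le_mul_of_nonneg_right h (hf0 x)
  · refine integral_mono_ae hi (hf.const_mul M) ?_
    filter_upwards [hM] with x h
    exact mul_le_mul_of_nonneg_right h (hf0 x)

end Integrability

/-- for `λ + μ < δ` the degenerate Nehari part `N⁰_{λ,μ}` is empty. -/
theorem NZero_empty
    (N : ℕ) (Ω : Set (Euc N)) (s : ℝ) (p : Euc N × Euc N → ℝ)
    (q α β a b c : Euc N → ℝ) (h : HypAll N Ω s p q α β a b c)
    (C₁ C₂ : ℝ) (hC₁ : 0 < C₁) (hC₂ : 1 < C₂)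
    (hQ : QEstimate Ω s p q a b C₁) (hR : REstimate Ω s p α β c C₂) :
    0 < deltaConst Ω p q α β C₁ C₂ ∧
    ∀ lam mu : ℝ, 0 < lam → 0 < mu → lam + mu < deltaConst Ω p q α β C₁ C₂ →
      ∀ u v : Euc N → ℝ, ¬ InNZero Ω s p q α β a b c lam mu u v := by
  obtain ⟨hN, hΩo, hΩb, hΩne, -, -, hp, -, -, hq, hα, hβ, hqp, hpA, -, -, -, -, hcm,
    ha0, hb0, hc0, ha, hb, ⟨M, hM⟩⟩ := h
  have hcl : (closure Ω).Nonempty := hΩne.closure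
  have hpp := hp.infOn_le_supOn univ_nonempty
  have hqq := hq.infOn_le_supOn hcl
  have hαα := hα.infOn_le_supOn hcl
  have hββ := hβ.infOn_le_supOn hcl
  have hp1 := hp.2.1
  have hq1 := hq.2.1
  have hα1 := hα.2.1
  have hβ1 := hβ.2.1
  constructor
  · have h1 : 0 < infOn α (closure Ω) + infOn β (closure Ω) - supOn p univ := by linarith
    have h2 : 0 < infOn α (closure Ω) + infOn β (closure Ω) - infOn q (closure Ω) := by linarith
    have h3 : 0 < infOn p univ - supOn q (closure Ω) := by linarith
    have h4 : 0 < supOn α (closure Ω) + supOn β (closure Ω) - supOn q (closure Ω) := by linarith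
    unfold deltaConst
    positivity
  rintro lam mu hlam hmu hlt u v ⟨⟨hu, hv, huv, hPQR⟩, hphi⟩
  have hγ : ∀ x ∈ Ω, 1 ≤ (α x + β x) / (α x + β x - q x) := fun x hx => by
    have hx' := subset_closure hx
    have := hq.le_supOn hx'
    have := hq.infOn_le hx'
    have := hα.infOn_le hx'
    have := hβ.infOn_le hx'
    rw [one_le_div (by linarith)]
    linarith
  have hai := ha.integrableOn hΩo hΩb hγ
  have hbi := hb.integrableOn hΩo hΩb hγ
  have hci : IntegrableOn c Ω :=
    Measure.integrableOn_of_bounded (M := M) hΩb.measure_lt_top.ne hcm.aestronglyMeasurable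
      (ae_of_all _ fun x => by rw [Real.norm_of_nonneg (hc0 x)]; exact hM x)
  have hQi : IntegrableOn (fun x => lam * a x * |u x| ^ q x + mu * b x * |v x| ^ q x) Ω := by
    refine integrableOn_of_trunc (C := C₁ * (lam + mu)) (lo := infOn q (closure Ω))
      (hi := supOn q (closure Ω)) hp hu hv
      (G := fun x t r => lam * a x * |t| ^ q x + mu * b x * |r| ^ q x) (fun x t r => ?_)
      (by positivity) (by linarith) (by linarith) (fun u v hu hv => hQ lam mu hlam hmu u v hu hv)
      fun k => ?_
    · have := ha0 x
      have := hb0 x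
      positivity
    · exact (integrableOn_mul_trunc_rpow hΩo hq hu.1 (hai.const_mul lam) k).add
        (integrableOn_mul_trunc_rpow hΩo hq hv.1 (hbi.const_mul mu) k)
  have hRi : IntegrableOn (fun x => c x * |u x| ^ α x * |v x| ^ β x) Ω := by
    refine integrableOn_of_trunc (C := C₂) (lo := infOn α (closure Ω) + infOn β (closure Ω))
      (hi := supOn α (closure Ω) + supOn β (closure Ω)) hp hu hv
      (G := fun x t r => c x * |t| ^ α x * |r| ^ β x) (fun x t r => ?_)
      (by linarith) (by linarith) (by linarith) (fun u v hu hv => hR u v hu hv)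
      fun k => ?_
    · have := hc0 x
      positivity
    · exact integrableOn_mul_trunc_rpow hΩo hβ hv.1
        (integrableOn_mul_trunc_rpow hΩo hα hu.1 hci k) k
  have hPi : Integrable fun z : Euc N × Euc N =>
      (|u z.1 - u z.2| ^ p z + |v z.1 - v z.2| ^ p z) / ‖z.1 - z.2‖ ^ ((N : ℝ) + s * p z) := by
    refine ((hu.integrable_density hp).add (hv.integrable_density hp)).congr
      (ae_of_all _ fun z => ?_)
    simp only [Pi.add_apply, gagliardoDensity, add_div]
  have hΩae : ∀ᵐ x ∂(volume.restrict Ω), x ∈ closure Ω :=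
    (ae_restrict_mem hΩo.measurableSet).mono fun x hx => subset_closure hx
  have hqm := hq.aemeasurable hΩo
  have hαm := hα.aemeasurable hΩo
  have hβm := hβ.aemeasurable hΩo
  have hP' := integral_mul_mem_Icc (g := fun z => p z - 1) (m := infOn p univ - 1)
    (M := supOn p univ - 1) hPi (fun z => by positivity)
    (hp.measurable.sub_const 1).aestronglyMeasurable
    (ae_of_all _ fun z => by linarith [hp.infOn_le (mem_univ z)])
    (ae_of_all _ fun z => by linarith [hp.le_supOn (mem_univ z)])
  have hQ' := integral_mul_mem_Icc (g := fun x => q x - 1) (m := infOn q (closure Ω) - 1)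
    (M := supOn q (closure Ω) - 1) hQi
    (fun x => by have := ha0 x; have := hb0 x; positivity)
    (hqm.sub_const 1).aestronglyMeasurable
    (hΩae.mono fun x hx => by linarith [hq.infOn_le hx])
    (hΩae.mono fun x hx => by linarith [hq.le_supOn hx])
  have hR' := integral_mul_mem_Icc (g := fun x => α x + β x - 1)
    (m := infOn α (closure Ω) + infOn β (closure Ω) - 1)
    (M := supOn α (closure Ω) + supOn β (closure Ω) - 1) hRi
    (fun x => by have := hc0 x; positivity)
    ((hαm.add hβm).sub_const 1).aestronglyMeasurable
    (hΩae.mono fun x hx => by linarith [hα.infOn_le hx, hβ.infOn_le hx])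
    (hΩae.mono fun x hx => by linarith [hα.le_supOn hx, hβ.le_supOn hx])
  simp only [← mul_div_assoc] at hP'
  change _ ∈ Icc (_ * Pfun s p u v) (_ * Pfun s p u v) at hP'
  change _ ∈ Icc (_ * Qfun Ω q a b lam mu u v) (_ * Qfun Ω q a b lam mu u v) at hQ'
  change _ ∈ Icc (_ * Rfun Ω α β c u v) (_ * Rfun Ω α β c u v) at hR'
  obtain ⟨hPl, hPu⟩ := hP'
  obtain ⟨hQl, hQu⟩ := hQ'
  obtain ⟨hRl, hRu⟩ := hR'
  rw [phiSecond] at hphi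
  exact nehari_inequalities_incompatible hqq hqp hpp hpA (by linarith) hC₁ hC₂
    (pairNorm_pos (by lia) hΩb hp hu hv huv) (min_pairNorm_rpow_le_Pfun hp hu hv)
    (hQ lam mu hlam hmu u v hu hv) (hR u v hu hv) (by linarith) (by linarith) (by linarith) hlt
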